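/- Total approximation error bound on the grid: let V*_t be the continuous-action value functions, V^h_t the finite-library value functions, and V̂^h_t the projected finite-library value functions defined on the grid B. Assume for each t = 0,…,H−1 a constant K_t ≥ 0 with |G(b,θ;V*_{t+1}) − G(b,θ';V*_{t+1})| ≤ K_t·d_Θ(θ,θ') for all b ∈ Δ_M and θ,θ' ∈ Θ, and assume each V^h_s is L^h_s-Lipschitz on Δ_M with respect to ‖·‖_∞. Then for every t = 0,…,H, sup_{b∈B} |V*_t(b) − V̂^h_t(b)| ≤ δ_A·Σ_{s=t}^{H−1} K_s + δ_B·Σ_{s=t+1}^{H} L^h_s. -/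

import Mathlib

open Finset ComplexOrder

/-- The belief simplex `Δ_M ⊆ ℝ^M`. -/
def simplex (M : ℕ) : Set (Fin M → ℝ) :=
  {b | (∀ i, 0 ≤ b i) ∧ ∑ i, b i = 1}

/-- The real number `Re Tr(E ρ)`, the Born-rule likelihood value. -/
noncomputable def trRe {d : ℕ} (E ρ : Matrix (Fin d) (Fin d) ℂ) : ℝ :=
  ((E * ρ).trace).re

/-- Observation probability `ObsProb(o | b, a) = Σ_j b j · Tr(E_o^{(a)} ρ_j)`. -/
noncomputable def obsProb {d M : ℕ} {O A : Type}
    (E : A → O → Matrix (Fin d) (Fin d) ℂ)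
    (ρ : Fin M → Matrix (Fin d) (Fin d) ℂ)
    (o : O) (b : Fin M → ℝ) (a : A) : ℝ :=
  ∑ j, b j * trRe (E a o) (ρ j)

/-- Bayesian posterior `τ(b,a,o)(i) = b i · Tr(E_o^{(a)} ρ_i) / ObsProb(o|b,a)`
(junk value when `ObsProb(o|b,a) = 0`, which only ever appears multiplied by a zero
observation probability). -/
noncomputable def bayes {d M : ℕ} {O A : Type}
    (E : A → O → Matrix (Fin d) (Fin d) ℂ)
    (ρ : Fin M → Matrix (Fin d) (Fin d) ℂ)
    (b : Fin M → ℝ) (a : A) (o : O) : Fin M → ℝ :=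
  fun i => b i * trRe (E a o) (ρ i) / obsProb E ρ o b a

/-- Stopping value `StopVal(b) = max_i b i`. -/
noncomputable def stopVal {M : ℕ} [NeZero M] (b : Fin M → ℝ) : ℝ :=
  univ.sup' univ_nonempty b

/-- Continuation functional
`G(b,θ;W) = −c_meas + Σ_o ObsProb(o|b,θ) · W(τ(b,θ,o))`
(outcomes with `ObsProb(o|b,θ) = 0` contribute zero). -/
noncomputable def contG {d M : ℕ} {O Θ : Type} [Fintype O]
    (E : Θ → O → Matrix (Fin d) (Fin d) ℂ)
    (ρ : Fin M → Matrix (Fin d) (Fin d) ℂ)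
    (c : ℝ) (b : Fin M → ℝ) (θ : Θ) (W : (Fin M → ℝ) → ℝ) : ℝ :=
  -c + ∑ o, obsProb E ρ o b θ * W (bayes E ρ b θ o)

section

variable {d M : ℕ} {O A : Type} {E : A → O → Matrix (Fin d) (Fin d) ℂ}
  {ρ : Fin M → Matrix (Fin d) (Fin d) ℂ}

open scoped MatrixOrder Matrix.Norms.L2Operator in
theorem trRe_nonneg {P Q : Matrix (Fin d) (Fin d) ℂ} (hP : P.PosSemidef) (hQ : Q.PosSemidef) :
    0 ≤ trRe P Q := by
  obtain ⟨R, rfl⟩ := CStarAlgebra.nonneg_iff_eq_star_mul_self.mp hQ.nonneg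
  have h : 0 ≤ (R * P * R.conjTranspose).trace := (hP.mul_mul_conjTranspose_same R).trace_nonneg
  rw [trRe, Matrix.star_eq_conjTranspose, ← Matrix.mul_assoc, Matrix.trace_mul_cycle]
  exact (Complex.le_def.mp h).1

theorem sum_trRe_eq_one [Fintype O] {P : O → Matrix (Fin d) (Fin d) ℂ} (hP : ∑ o, P o = 1)
    {Q : Matrix (Fin d) (Fin d) ℂ} (hQ : Q.trace = 1) : ∑ o, trRe (P o) Q = 1 := by
  simp only [trRe]
  rw [← Complex.re_sum, ← Matrix.trace_sum, ← Matrix.sum_mul, hP, Matrix.one_mul, hQ,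
    Complex.one_re]

theorem obsProb_nonneg (hρ : ∀ i, (ρ i).PosSemidef) (hE : ∀ a o, (E a o).PosSemidef)
    {b : Fin M → ℝ} (hb : b ∈ simplex M) (a : A) (o : O) : 0 ≤ obsProb E ρ o b a :=
  sum_nonneg fun j _ => mul_nonneg (hb.1 j) (trRe_nonneg (hE a o) (hρ j))

theorem sum_obsProb_eq_one [Fintype O] (hρ : ∀ i, (ρ i).trace = 1) (hE : ∀ a, ∑ o, E a o = 1)
    {b : Fin M → ℝ} (hb : b ∈ simplex M) (a : A) : ∑ o, obsProb E ρ o b a = 1 := by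
  simp only [obsProb]
  rw [sum_comm]
  simp only [← mul_sum, sum_trRe_eq_one (hE a) (hρ _), mul_one, hb.2]

theorem bayes_mem_simplex (hρ : ∀ i, (ρ i).PosSemidef) (hE : ∀ a o, (E a o).PosSemidef)
    {b : Fin M → ℝ} (hb : b ∈ simplex M) (a : A) (o : O) (h : obsProb E ρ o b a ≠ 0) :
    bayes E ρ b a o ∈ simplex M := by
  refine ⟨fun i => div_nonneg (mul_nonneg (hb.1 i) (trRe_nonneg (hE a o) (hρ i)))
    (obsProb_nonneg hρ hE hb a o), ?_⟩
  simp only [bayes]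
  rw [← sum_div]
  exact div_self h

end

theorem abs_sum_mul_sub_sum_mul_le {ι : Type*} [Fintype ι] {p f g : ι → ℝ} {ε : ℝ}
    (hp : ∀ i, 0 ≤ p i) (hsum : ∑ i, p i = 1) (h : ∀ i, p i ≠ 0 → |f i - g i| ≤ ε) :
    |∑ i, p i * f i - ∑ i, p i * g i| ≤ ε := by
  rw [← sum_sub_distrib]
  calc |∑ i, (p i * f i - p i * g i)| ≤ ∑ i, |p i * f i - p i * g i| := abs_sum_le_sum_abs _ _
    _ ≤ ∑ i, p i * ε := by
        refine sum_le_sum fun i _ => ?_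
        rw [← mul_sub, abs_mul, abs_of_nonneg (hp i)]
        by_cases hi : p i = 0
        · simp [hi]
        · exact mul_le_mul_of_nonneg_left (h i hi) (hp i)
    _ = ε := by rw [← sum_mul, hsum, one_mul]

theorem abs_max_sub_max_left_le {a x y ε : ℝ} (h : |x - y| ≤ ε) : |max a x - max a y| ≤ ε := by
  rw [max_comm a, max_comm a]
  exact (abs_max_sub_max_le_abs x y a).trans h

theorem Finset.abs_sup'_sub_sup'_le {ι : Type*} {s : Finset ι} (hs : s.Nonempty) {f g : ι → ℝ}
    {ε : ℝ} (h : ∀ i ∈ s, |f i - g i| ≤ ε) : |s.sup' hs f - s.sup' hs g| ≤ ε := by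
  have key : ∀ f g : ι → ℝ, (∀ i ∈ s, |f i - g i| ≤ ε) → s.sup' hs f - s.sup' hs g ≤ ε := by
    intro f g h
    rw [sub_le_iff_le_add]
    refine sup'_le hs f fun i hi => ?_
    linarith [(abs_le.mp (h i hi)).2, le_sup' g hi]
  refine abs_sub_le_iff.mpr ⟨key f g h, key g f fun i hi => ?_⟩
  rw [abs_sub_comm]
  exact h i hi

/-- The supremum of a Lipschitz function is approximated by its maximum over a finite net. -/
theorem abs_ciSup_sub_sup'_le {X : Type*} [PseudoMetricSpace X] {s : Finset X} (hs : s.Nonempty)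
    {f : X → ℝ} {k δ : ℝ} (hk : 0 ≤ k) (hf : ∀ x y, |f x - f y| ≤ k * dist x y)
    (hδ : ∀ x, ∃ y ∈ s, dist x y ≤ δ) : |(⨆ x, f x) - s.sup' hs f| ≤ k * δ := by
  have hle : ∀ x, f x ≤ s.sup' hs f + k * δ := by
    intro x
    obtain ⟨y, hy, hxy⟩ := hδ x
    linarith [(abs_le.mp (hf x y)).2, le_sup' f hy, mul_le_mul_of_nonneg_left hxy hk]
  have : Nonempty X := ⟨hs.choose⟩
  have hbdd : BddAbove (Set.range f) := ⟨_, Set.forall_mem_range.mpr hle⟩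
  have hsup : s.sup' hs f ≤ ⨆ x, f x := sup'_le hs f fun x _ => le_ciSup hbdd x
  rw [abs_of_nonneg (sub_nonneg.mpr hsup), sub_le_iff_le_add']
  exact ciSup_le hle

/-- Total approximation error bound on the grid: with `V*_t` the continuous-action value
functions, `V^h_t` the finite-library value functions, and `V̂^h_t` the projected
finite-library value functions on the grid `B`, assuming `G(b,·;V*_{t+1})` is
`K_t`-Lipschitz in the action parameter (uniformly in `b ∈ Δ_M`) and each `V^h_s` is
`L^h_s`-Lipschitz on `Δ_M` w.r.t. `‖·‖_∞`, one has for every `t = 0,…,H`: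
`sup_{b∈B} |V*_t(b) − V̂^h_t(b)| ≤ δ_A·Σ_{s=t}^{H−1} K_s + δ_B·Σ_{s=t+1}^{H} L^h_s`. -/
theorem total_approximation_error
    (d M : ℕ) (hd : 0 < d) [NeZero M]
    (O : Type) [Fintype O] [Nonempty O]
    (Θ : Type) [MetricSpace Θ]
    (ρ : Fin M → Matrix (Fin d) (Fin d) ℂ)
    (hρpsd : ∀ i, (ρ i).PosSemidef) (hρtr : ∀ i, (ρ i).trace = 1)
    (E : Θ → O → Matrix (Fin d) (Fin d) ℂ)
    (hEpsd : ∀ θ o, (E θ o).PosSemidef) (hEsum : ∀ θ, ∑ o, E θ o = 1)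
    (H : ℕ) (c : ℝ)
    (Θh : Finset Θ) (hΘh : Θh.Nonempty)
    (δA : ℝ) (hδA : ∀ θ : Θ, ∃ θb ∈ Θh, dist θ θb ≤ δA)
    (B : Finset (Fin M → ℝ)) (hBne : B.Nonempty) (hBsub : ∀ x ∈ B, x ∈ simplex M)
    (proj : (Fin M → ℝ) → (Fin M → ℝ)) (hproj : ∀ x ∈ simplex M, proj x ∈ B)
    (δB : ℝ) (hδB : ∀ x ∈ simplex M, ‖x - proj x‖ ≤ δB)
    (Vstar : ℕ → (Fin M → ℝ) → ℝ)
    (hVstarH : ∀ b ∈ simplex M, Vstar H b = stopVal b)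
    (hVstarRec : ∀ t < H, ∀ b ∈ simplex M,
      Vstar t b = max (stopVal b) (⨆ θ : Θ, contG E ρ c b θ (Vstar (t + 1))))
    (Vh : ℕ → (Fin M → ℝ) → ℝ)
    (hVhH : ∀ b ∈ simplex M, Vh H b = stopVal b)
    (hVhRec : ∀ t < H, ∀ b ∈ simplex M,
      Vh t b = max (stopVal b) (Θh.sup' hΘh fun θb => contG E ρ c b θb (Vh (t + 1))))
    (Vhath : ℕ → (Fin M → ℝ) → ℝ)
    (hVhathH : ∀ b ∈ B, Vhath H b = stopVal b)
    (hVhathRec : ∀ t < H, ∀ b ∈ B,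
      Vhath t b = max (stopVal b)
        (Θh.sup' hΘh fun θb =>
          -c + ∑ o, obsProb E ρ o b θb * Vhath (t + 1) (proj (bayes E ρ b θb o))))
    (K : ℕ → ℝ) (hK0 : ∀ t, 0 ≤ K t)
    (hKLip : ∀ t < H, ∀ b ∈ simplex M, ∀ θ θ' : Θ,
      |contG E ρ c b θ (Vstar (t + 1)) - contG E ρ c b θ' (Vstar (t + 1))|
        ≤ K t * dist θ θ')
    (Lh : ℕ → ℝ) (hLh0 : ∀ s, 0 ≤ Lh s)
    (hLhLip : ∀ s ≤ H, ∀ b ∈ simplex M, ∀ b' ∈ simplex M,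
      |Vh s b - Vh s b'| ≤ Lh s * ‖b - b'‖) :
    ∀ t ≤ H, ∀ b ∈ B,
      |Vstar t b - Vhath t b|
        ≤ δA * ∑ s ∈ Finset.Ico t H, K s + δB * ∑ s ∈ Finset.Icc (t + 1) H, Lh s := by
  have hstar : ∀ t ≤ H, ∀ b ∈ simplex M, |Vstar t b - Vh t b| ≤ δA * ∑ s ∈ Ico t H, K s := by
    intro t ht
    induction ht using Nat.decreasingInduction with
    | self => intro b hb; simp [hVstarH b hb, hVhH b hb]
    | of_succ t ht ih =>
      intro b hb
      rw [hVstarRec t ht b hb, hVhRec t ht b hb, sum_eq_sum_Ico_succ_bot ht, mul_add]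
      refine abs_max_sub_max_left_le ((abs_sub_le _ _ _).trans (add_le_add
        ((abs_ciSup_sub_sup'_le hΘh (hK0 t) (hKLip t ht b hb) hδA).trans_eq (mul_comm _ _))
        (abs_sup'_sub_sup'_le hΘh fun θ _ => ?_)))
      rw [contG, contG, add_sub_add_left_eq_sub]
      exact abs_sum_mul_sub_sum_mul_le (obsProb_nonneg hρpsd hEpsd hb θ)
        (sum_obsProb_eq_one hρtr hEsum hb θ)
        fun o ho => ih _ (bayes_mem_simplex hρpsd hEpsd hb θ o ho)
  have hgrid : ∀ t ≤ H, ∀ b ∈ B, |Vh t b - Vhath t b| ≤ δB * ∑ s ∈ Icc (t + 1) H, Lh s := by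
    intro t ht
    induction ht using Nat.decreasingInduction with
    | self => intro b hb; simp [hVhH b (hBsub b hb), hVhathH b hb]
    | of_succ t ht ih =>
      intro b hb
      have hb' := hBsub b hb
      rw [hVhRec t ht b hb', hVhathRec t ht b hb]
      refine abs_max_sub_max_left_le (abs_sup'_sub_sup'_le hΘh fun θ _ => ?_)
      rw [contG, add_sub_add_left_eq_sub]
      refine abs_sum_mul_sub_sum_mul_le (obsProb_nonneg hρpsd hEpsd hb' θ)
        (sum_obsProb_eq_one hρtr hEsum hb' θ) fun o ho => ?_
      have hx := bayes_mem_simplex hρpsd hEpsd hb' θ o ho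
      have hlip := (hLhLip (t + 1) ht _ hx _ (hBsub _ (hproj _ hx))).trans
        (mul_le_mul_of_nonneg_left (hδB _ hx) (hLh0 (t + 1)))
      have hsum : ∑ s ∈ Icc (t + 1) H, Lh s = Lh (t + 1) + ∑ s ∈ Icc (t + 1 + 1) H, Lh s := by
        simp only [← Ico_add_one_right_eq_Icc]
        exact sum_eq_sum_Ico_succ_bot (by omega) _
      rw [hsum, mul_add, mul_comm δB (Lh (t + 1))]
      exact (abs_sub_le _ _ _).trans (add_le_add hlip (ih _ (hproj _ hx)))
  intro t ht b hb
  exact (abs_sub_le _ (Vh t b) _).trans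
    (add_le_add (hstar t ht b (hBsub b hb)) (hgrid t ht b hb))
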